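/- Suppose for each v in [v̲, v̄] (with v̲ < v̄), H_v is the CDF of an integrable probability distribution on ℝ with continuous strictly positive density h_v on the interval (V̲, V̄), where −∞ ≤ V̲ < V̄ ≤ ∞; for each fixed V in (V̲, V̄), the map v ↦ H_v(V) is continuously differentiable with ∂H_v(V)/∂v < 0 for all v; there exists an integrable function b : (V̲, V̄) → ℝ≥0 with |∂H_v(V)/∂v| ≤ b(V) for all v and V; and the normalization ∫ V h_v(V) dV = v holds for every v in [v̲, v̄]. Then Assumptions A1 and A2 both hold if and only if there exists a CDF G with continuous strictly positive density on all of ℝ and mean zero (∫ x dG(x) = 0) such that H_v(x) = G(x − v) for all v in [v̲, v̄] and all real x; equivalently, V − v is a full-support, mean-zero random variable that is independent of v. -/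

import Mathlib

open MeasureTheory Set

/-- The open interval `(a, b)` of real numbers, where the endpoints `a, b` are extended
reals (so `a = ⊥` means unbounded below and `b = ⊤` means unbounded above). -/
def ERIoo (a b : EReal) : Set ℝ := {x : ℝ | a < (x : EReal) ∧ (x : EReal) < b}

open Filter Topology Function

theorem setIntegral_Iic_eq_add_intervalIntegral {f : ℝ → ℝ} (hf : Integrable f) (a x : ℝ) :
    ∫ t in Iic x, f t = (∫ t in Iic a, f t) + ∫ t in a..x, f t := by
  rw [← intervalIntegral.integral_Iic_sub_Iic hf.integrableOn hf.integrableOn]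
  ring

theorem continuous_setIntegral_Iic {f : ℝ → ℝ} (hf : Integrable f) :
    Continuous fun x => ∫ t in Iic x, f t := by
  rw [funext (setIntegral_Iic_eq_add_intervalIntegral hf 0)]
  exact continuous_const.add
    (intervalIntegral.continuous_primitive (fun _ _ => hf.intervalIntegrable) 0)

theorem hasDerivAt_setIntegral_Iic {f : ℝ → ℝ} (hf : Integrable f) {x : ℝ} {s : Set ℝ}
    (hs : IsOpen s) (hx : x ∈ s) (hc : ContinuousOn f s) :
    HasDerivAt (fun x => ∫ t in Iic x, f t) (f x) x := by
  rw [funext (setIntegral_Iic_eq_add_intervalIntegral hf x)]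
  exact (intervalIntegral.integral_hasDerivAt_right hf.intervalIntegrable
    (hf.aestronglyMeasurable.stronglyMeasurableAtFilter)
    (hc.continuousAt (hs.mem_nhds hx))).const_add _

/-- The tail formula for the mean: `∫ (F x - 1_{0 ≤ x}) dx = - ∫ t f t dt` for the distribution
function `F` of a density `f`. -/
theorem integrable_and_integral_setIntegral_Iic_sub_indicator {f : ℝ → ℝ} (hf : Integrable f)
    (h1 : ∫ t, f t = 1) (hxf : Integrable fun t => t * f t) :
    Integrable (fun x => (∫ t in Iic x, f t) - (Ici (0 : ℝ)).indicator 1 x) ∧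
      ∫ x, ((∫ t in Iic x, f t) - (Ici (0 : ℝ)).indicator 1 x) = - ∫ t, t * f t := by
  set k : ℝ → ℝ → ℝ := fun x t =>
    (Ico t 0).indicator (fun _ => 1) x - (Ico 0 t).indicator (fun _ => 1) x with hk
  have hkm : Measurable (uncurry k) := by
    have e : uncurry k = fun p : ℝ × ℝ =>
        ({p : ℝ × ℝ | p.2 ≤ p.1 ∧ p.1 < 0}.indicator (fun _ => (1 : ℝ)) p) -
        ({p : ℝ × ℝ | 0 ≤ p.1 ∧ p.1 < p.2}.indicator (fun _ => (1 : ℝ)) p) := by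
      ext ⟨x, t⟩
      simp [hk, uncurry, indicator]
    rw [e]
    refine (measurable_const.indicator ?_).sub (measurable_const.indicator ?_)
    · exact (measurableSet_le measurable_snd measurable_fst).inter
        (measurableSet_lt measurable_fst measurable_const)
    · exact (measurableSet_le measurable_const measurable_fst).inter
        (measurableSet_lt measurable_fst measurable_snd)
  have hind : ∀ a b : ℝ, Integrable ((Ico a b).indicator fun _ => (1 : ℝ)) := fun a b =>
    (integrable_indicator_iff measurableSet_Ico).2 (by simp)
  have hindI : ∀ a b : ℝ, ∫ x, (Ico a b).indicator (fun _ => (1 : ℝ)) x = max (b - a) 0 := by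
    intro a b
    rw [integral_indicator measurableSet_Ico]
    simp [Measure.real, ENNReal.toReal_ofReal']
  have hki : ∀ t, Integrable fun x => k x t := fun t => (hind t 0).sub (hind 0 t)
  have hkI : ∀ t, ∫ x, k x t = -t := by
    intro t
    simp only [hk]
    rw [integral_sub (hind t 0) (hind 0 t), hindI, hindI]
    rcases le_total t 0 with h | h
    · rw [max_eq_left, max_eq_right] <;> linarith
    · rw [max_eq_right, max_eq_left] <;> linarith
  have hkA : ∀ t, ∫ x, |k x t| = |t| := by
    intro t
    rcases le_total t 0 with h | h
    · have : ∀ x, |k x t| = k x t := by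
        intro x
        simp [hk, Ico_eq_empty_of_le h, abs_of_nonneg, indicator_nonneg]
      simp_rw [this, hkI, abs_of_nonpos h]
    · have : ∀ x, |k x t| = - k x t := by
        intro x
        simp [hk, Ico_eq_empty_of_le h, abs_of_nonneg, indicator_nonneg]
      simp_rw [this, integral_neg, hkI, abs_of_nonneg h, neg_neg]
  have hint : Integrable (uncurry fun x t => k x t * f t) (volume.prod volume) := by
    have hm : AEStronglyMeasurable (uncurry fun x t => k x t * f t) (volume.prod volume) :=
      hkm.aestronglyMeasurable.mul hf.aestronglyMeasurable.comp_snd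
    rw [integrable_prod_iff' hm]
    refine ⟨ae_of_all _ fun t => (hki t).mul_const (f t), ?_⟩
    refine hxf.norm.congr (ae_of_all _ fun t => ?_)
    simp only [uncurry, norm_mul, Real.norm_eq_abs, integral_mul_const, hkA]
  have hinner : ∀ x, ∫ t, k x t * f t =
      (∫ t in Iic x, f t) - (Ici (0 : ℝ)).indicator 1 x := by
    intro x
    have e : ∀ t, k x t * f t =
        (Iic x).indicator f t - (Ici (0 : ℝ)).indicator 1 x * f t := by
      intro t
      simp only [hk, indicator, mem_Ico, mem_Iic, mem_Ici, Pi.one_apply]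
      split_ifs <;> grind
    simp_rw [e]
    rw [integral_sub (hf.indicator measurableSet_Iic) (hf.const_mul _),
      integral_indicator measurableSet_Iic, integral_const_mul, h1, mul_one]
  constructor
  · simpa only [uncurry, hinner] using hint.integral_prod_left
  · simp_rw [← hinner]
    rw [integral_integral_swap hint]
    simp_rw [integral_mul_const, hkI, neg_mul, integral_neg]

/-- If `μ` is strictly stochastically dominated by `ν` on `I`, and `s ≤ r` are nonnegative antitone
functions on `I` with `∫ r dμ = ∫ s dν < ∞`, then `r` is constant on `I`. -/
theorem eq_of_lintegral_eq_of_measure_Iic_lt {I : Set ℝ} (hI : I.OrdConnected)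
    {μ ν : Measure ℝ} [IsProbabilityMeasure μ] [IsProbabilityMeasure ν] [NullSingletonClass μ] [NullSingletonClass ν]
    (hμ : μ Iᶜ = 0) (hν : ν Iᶜ = 0) (hlt : ∀ x ∈ I, ν (Iic x) < μ (Iic x))
    {r s : ℝ → ℝ} (hr : AntitoneOn r I) (hs : AntitoneOn s I)
    (hs0 : ∀ x ∈ I, 0 ≤ s x) (hsr : ∀ x ∈ I, s x ≤ r x)
    (hfin : ∫⁻ x, ENNReal.ofReal (s x) ∂ν ≠ ⊤)
    (heq : ∫⁻ x, ENNReal.ofReal (r x) ∂μ = ∫⁻ x, ENNReal.ofReal (s x) ∂ν) :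
    ∀ p ∈ I, ∀ q ∈ I, r p = r q := by
  have hIm : MeasurableSet I := hI.measurableSet
  have key : ∀ t, ∀ {ρ : Measure ℝ} [IsProbabilityMeasure ρ] [NullSingletonClass ρ], ρ Iᶜ = 0 →
      ∀ p ∈ I, ∀ q ∈ I, t < r p → r q ≤ t →
      ρ {x | t < r x} = ρ (Iic (sSup {x ∈ I | t < r x})) ∧ sSup {x ∈ I | t < r x} ∈ I := by
    intro t ρ _ _ hρ p hp q hq htp htq
    set L := {x ∈ I | t < r x} with hL
    have hub : ∀ x ∈ L, x ≤ q := by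
      intro x hx
      by_contra! hc
      have := hr hq hx.1 hc.le
      linarith [hx.2]
    have hbdd : BddAbove L := ⟨q, hub⟩
    have hpL : p ∈ L := ⟨hp, htp⟩
    have hsI : sSup L ∈ I := hI.out hp hq ⟨le_csSup hbdd hpL, csSup_le ⟨p, hpL⟩ hub⟩
    refine ⟨?_, hsI⟩
    apply measure_congr
    have hae : ∀ᵐ x ∂ρ, x ∈ I := by
      rw [ae_iff]; exact hρ
    have hne : ∀ᵐ x ∂ρ, x ≠ sSup L := by
      rw [ae_iff]; simp
    filter_upwards [hae, hne] with x hxI hxs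
    apply propext
    change t < r x ↔ x ≤ sSup L
    constructor
    · intro h
      exact le_csSup hbdd ⟨hxI, h⟩
    · intro h
      obtain ⟨y, hy, hxy⟩ := exists_lt_of_lt_csSup ⟨p, hpL⟩ (lt_of_le_of_ne h hxs)
      exact hy.2.trans_le (hr hxI hy.1 hxy.le)
  have hle1 : ∀ t, ν {x | t < s x} ≤ ν {x | t < r x} := by
    intro t
    apply measure_mono_ae
    have hae : ∀ᵐ x ∂ν, x ∈ I := by
      rw [ae_iff]; exact hν
    filter_upwards [hae] with x hx h
    exact lt_of_lt_of_le h (hsr x hx)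
  have hle2 : ∀ t, ν {x | t < r x} ≤ μ {x | t < r x} := by
    intro t
    by_cases h1 : ∃ p ∈ I, t < r p
    · by_cases h2 : ∃ q ∈ I, r q ≤ t
      · obtain ⟨p, hp, htp⟩ := h1
        obtain ⟨q, hq, htq⟩ := h2
        obtain ⟨e1, hm⟩ := key t hν p hp q hq htp htq
        obtain ⟨e2, -⟩ := key t hμ p hp q hq htp htq
        rw [e1, e2]
        exact (hlt _ hm).le
      · push Not at h2
        calc ν {x | t < r x} ≤ μ univ := by rw [measure_univ]; exact prob_le_one
          _ ≤ μ {x | t < r x} := measure_mono_ae <| by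
            have hae : ∀ᵐ x ∂μ, x ∈ I := by
              rw [ae_iff]; exact hμ
            filter_upwards [hae] with x hx _ using h2 x hx
    · push Not at h1
      have : ν {x | t < r x} = 0 :=
        measure_mono_null (t := Iᶜ) (fun x hx hxI => absurd (h1 x hxI) (not_le.2 hx)) hν
      simp [this]
  have haem : ∀ {ρ : Measure ℝ}, ρ Iᶜ = 0 → ∀ {u : ℝ → ℝ}, AntitoneOn u I → AEMeasurable u ρ := by
    intro ρ hρ u hu
    have : ρ.restrict I = ρ := Measure.restrict_eq_self_of_ae_mem (by rw [ae_iff]; exact hρ)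
    rw [← this]
    exact aemeasurable_restrict_of_antitoneOn hIm hu
  have hnn : ∀ {ρ : Measure ℝ}, ρ Iᶜ = 0 → ∀ {u : ℝ → ℝ}, (∀ x ∈ I, 0 ≤ u x) → 0 ≤ᵐ[ρ] u := by
    intro ρ hρ u hu
    have hae : ∀ᵐ x ∂ρ, x ∈ I := by
      rw [ae_iff]; exact hρ
    filter_upwards [hae] with x hx using hu x hx
  rw [lintegral_eq_lintegral_meas_lt ν (hnn hν hs0) (haem hν hs)] at heq hfin
  rw [lintegral_eq_lintegral_meas_lt μ (hnn hμ fun x hx => (hs0 x hx).trans (hsr x hx))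
    (haem hμ hr)] at heq
  have hnlt : ∀ p ∈ I, ∀ q ∈ I, ¬ r q < r p := by
    intro p hp q hq hpq
    refine heq.not_gt (lintegral_strict_mono_of_ae_le_of_ae_lt_on (s := Ioo (r q) (r p)) ?_ hfin
      (ae_of_all _ fun t => (hle1 t).trans (hle2 t)) ?_ (ae_of_all _ fun t ht => ?_))
    · refine Antitone.measurable ?_ |>.aemeasurable
      intro t t' h
      exact measure_mono fun x hx => lt_of_le_of_lt h hx
    · have h0 : 0 ≤ r q := (hs0 q hq).trans (hsr q hq)
      rw [Measure.restrict_apply measurableSet_Ioo,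
        inter_eq_left.2 fun x (hx : x ∈ Ioo _ _) => mem_Ioi.2 (lt_of_le_of_lt h0 hx.1)]
      simpa using hpq
    · refine (hle1 t).trans_lt ?_
      obtain ⟨e1, hm⟩ := key t hν p hp q hq ht.2 ht.1.le
      obtain ⟨e2, -⟩ := key t hμ p hp q hq ht.2 ht.1.le
      rw [e1, e2]
      exact hlt _ hm
  intro p hp q hq
  exact le_antisymm (not_lt.1 (hnlt p hp q hq)) (not_lt.1 (hnlt q hq p hp))

theorem continuousAt_uncurry_of_monotone {F : ℝ → ℝ → ℝ} {v x : ℝ}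
    (hmono : ∀ᶠ w in 𝓝 v, Monotone (F w)) (hx : ContinuousAt (F v) x)
    (hv : ∀ y, ContinuousAt (fun w => F w y) v) : ContinuousAt (uncurry F) (v, x) := by
  rw [ContinuousAt, tendsto_order]
  have hl : Tendsto (F v) (𝓝[<] x) (𝓝 (F v x)) := hx.mono_left nhdsWithin_le_nhds
  have hr : Tendsto (F v) (𝓝[>] x) (𝓝 (F v x)) := hx.mono_left nhdsWithin_le_nhds
  constructor
  · intro c hc
    obtain ⟨y, hy, hyx⟩ := ((hl.eventually_const_lt hc).and self_mem_nhdsWithin).exists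
    rw [nhds_prod_eq]
    filter_upwards [(hmono.and ((hv y).eventually_const_lt hy)).prod_mk
      (Ioi_mem_nhds hyx)] with p hp
    exact hp.1.2.trans_le (hp.1.1 (le_of_lt hp.2))
  · intro c hc
    obtain ⟨y, hy, hyx⟩ := ((hr.eventually_lt_const hc).and self_mem_nhdsWithin).exists
    rw [nhds_prod_eq]
    filter_upwards [(hmono.and ((hv y).eventually_lt_const hy)).prod_mk
      (Iio_mem_nhds hyx)] with p hp
    exact (hp.1.1 (le_of_lt hp.2)).trans_lt hp.1.2

/-- If a family of distribution functions solves the transport equation `∂F/∂v = -∂F/∂x`, then it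
is a translation family. -/
theorem eq_translate_of_hasDerivAt_neg_density {a b : ℝ} {f : ℝ → ℝ → ℝ} {B : ℝ → ℝ}
    (hf : ∀ v ∈ Ioo a b, Integrable (f v)) (hf0 : ∀ v ∈ Ioo a b, ∀ x, 0 ≤ f v x)
    (hB : Integrable B) (hfB : ∀ v ∈ Ioo a b, ∀ x, f v x ≤ B x)
    (hd : ∀ v ∈ Ioo a b, ∀ x, HasDerivAt (fun w => ∫ t in Iic x, f w t) (-f v x) v)
    {v w : ℝ} (hv : v ∈ Ioo a b) (hw : w ∈ Ioo a b) (y : ℝ) :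
    ∫ t in Iic (v + y), f v t = ∫ t in Iic (w + y), f w t := by
  set F : ℝ → ℝ → ℝ := fun v x => ∫ t in Iic x, f v t with hF
  have hFc : ∀ v ∈ Ioo a b, Continuous (F v) := fun v hv => continuous_setIntegral_Iic (hf v hv)
  have hFm : ∀ v ∈ Ioo a b, Monotone (F v) := fun v hv x y hxy =>
    setIntegral_mono_set (hf v hv).integrableOn (ae_of_all _ (hf0 v hv))
      (Iic_subset_Iic.2 hxy).eventuallyLE
  have hjoint : ∀ v ∈ Ioo a b, ∀ x, ContinuousAt (uncurry F) (v, x) := fun v hv x =>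
    continuousAt_uncurry_of_monotone (by filter_upwards [isOpen_Ioo.mem_nhds hv] using hFm)
      (hFc v hv).continuousAt fun y => (hd v hv y).continuousAt
  set K : ℝ → ℝ → ℝ := fun v x => ∫ t in (0 : ℝ)..x, F v t with hK
  have hKx : ∀ v ∈ Ioo a b, ∀ x, HasDerivAt (K v) (F v x) x := fun v hv x =>
    intervalIntegral.integral_hasDerivAt_right ((hFc v hv).intervalIntegrable _ _)
      ((hFc v hv).stronglyMeasurableAtFilter _ _) (hFc v hv).continuousAt
  have hKv : ∀ v ∈ Ioo a b, ∀ x, HasDerivAt (fun w => K w x) (F v 0 - F v x) v := by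
    intro v hv x
    have h := (intervalIntegral.hasDerivAt_integral_of_dominated_loc_of_deriv_le (a := 0) (b := x)
      (μ := volume) (F := F) (F' := fun v x => - f v x) (bound := B) (isOpen_Ioo.mem_nhds hv)
      (by filter_upwards [isOpen_Ioo.mem_nhds hv] with w hw using (hFc w hw).aestronglyMeasurable)
      ((hFc v hv).intervalIntegrable _ _) (hf v hv).neg.aestronglyMeasurable.restrict
      (ae_of_all _ fun t _ w hw => by
        rw [norm_neg, Real.norm_of_nonneg (hf0 w hw t)]; exact hfB w hw t)
      hB.intervalIntegrable (ae_of_all _ fun t _ w hw => hd w hw t)).2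
    have e : ∫ t in (0 : ℝ)..x, -f v t = F v 0 - F v x := by
      have := setIntegral_Iic_eq_add_intervalIntegral (hf v hv) 0 x
      rw [intervalIntegral.integral_neg]
      simp only [hF]
      linarith
    exact e ▸ h
  have hKd : ∀ y, ∀ v ∈ Ioo a b, HasDerivAt (fun w => K w (w + y)) (F v 0) v := by
    intro y v hv
    have hU : ∀ᶠ p : ℝ × ℝ in 𝓝 (v, v + y), p.1 ∈ Ioo a b :=
      continuousAt_fst.eventually (isOpen_Ioo.mem_nhds hv)
    have hst := hasStrictFDerivAt_uncurry_coprod (𝕜 := ℝ) (u := (v, v + y)) (f := K)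
      (f₁ := fun v x => ContinuousLinearMap.toSpanSingleton ℝ (F v 0 - F v x))
      (f₂ := fun v x => ContinuousLinearMap.toSpanSingleton ℝ (F v x))
      (by filter_upwards [hU] with p hp using (hKv p.1 hp p.2).hasFDerivAt)
      (by filter_upwards [hU] with p hp using (hKx p.1 hp p.2).hasFDerivAt)
      (by
        have h0 : ContinuousAt (fun p : ℝ × ℝ => F p.1 0) (v, v + y) :=
          ContinuousAt.comp (f := Prod.fst) (g := fun w => F w 0)
            (hd v hv 0).continuousAt continuousAt_fst
        exact (ContinuousLinearMap.toSpanSingletonCLE (𝕜 := ℝ) (E := ℝ)).continuous.continuousAt.comp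
          (h0.sub (hjoint v hv (v + y))))
      (by
        exact (ContinuousLinearMap.toSpanSingletonCLE (𝕜 := ℝ) (E := ℝ)).continuous.continuousAt.comp
          (hjoint v hv (v + y)))
    have := hst.hasFDerivAt.comp_hasDerivAt v
      ((hasDerivAt_id v).prodMk ((hasDerivAt_id v).add_const y))
    refine this.congr_deriv ?_
    change ((1 : ℝ) • (F v 0 - F v (v + y)) + (1 : ℝ) • F v (v + y)) = F v 0
    simp
  have hconst : ∀ y, K v (v + y) - K v (v + 0) = K w (w + y) - K w (w + 0) := by
    intro y
    have hder : ∀ u ∈ Ioo a b, HasDerivAt (fun u => K u (u + y) - K u (u + 0)) 0 u := by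
      intro u hu
      exact ((hKd y u hu).sub (hKd 0 u hu)).congr_deriv (sub_self _)
    exact isOpen_Ioo.is_const_of_deriv_eq_zero isPreconnected_Ioo
      (fun u hu => (hder u hu).differentiableAt.differentiableWithinAt)
      (fun u hu => (hder u hu).deriv) hv hw
  have h1 : HasDerivAt (fun y => K v (v + y) - K v (v + 0)) (F v (v + y)) y :=
    ((hKx v hv (v + y)).comp_const_add v y).sub_const _
  rw [funext hconst] at h1
  exact h1.unique (((hKx w hw (w + y)).comp_const_add w y).sub_const _)

theorem isOpen_ERIoo (a b : EReal) : IsOpen (ERIoo a b) :=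
  isOpen_Ioo.preimage continuous_coe_real_ereal

theorem ordConnected_ERIoo (a b : EReal) : (ERIoo a b).OrdConnected :=
  ⟨fun _ hx _ hy _ hz => ⟨hx.1.trans_le (EReal.coe_le_coe_iff.2 hz.1),
    (EReal.coe_le_coe_iff.2 hz.2).trans_lt hy.2⟩⟩

theorem Set.OrdConnected.inter_Iic_eq_empty_or_self {I : Set ℝ} (hI : I.OrdConnected) {x : ℝ}
    (hx : x ∉ I) : I ∩ Iic x = ∅ ∨ I ∩ Iic x = I := by
  by_cases h : ∃ y ∈ I, y ≤ x
  · obtain ⟨y, hy, hyx⟩ := h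
    right
    refine inter_eq_left.2 fun z hz => ?_
    by_contra hzx
    exact hx (hI.out hy hz ⟨hyx, (not_le.1 hzx).le⟩)
  · left
    push Not at h
    exact eq_empty_of_forall_notMem fun z hz => absurd hz.2 (not_le.2 (h z hz.1))

theorem setIntegral_Iic_indicator {I : Set ℝ} (hI : MeasurableSet I) (f : ℝ → ℝ) (x : ℝ) :
    ∫ t in Iic x, I.indicator f t = ∫ t in I ∩ Iic x, f t := by
  rw [setIntegral_indicator hI, inter_comm]

theorem hasDerivAt_setIntegral_Iic_indicator {I : Set ℝ} (hI : I.OrdConnected) {a b : ℝ}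
    {H h Hv : ℝ → ℝ → ℝ}
    (hcdf : ∀ v ∈ Icc a b, ∀ x ∈ I, H v x = ∫ t in I ∩ Iic x, h v t)
    (hmass : ∀ v ∈ Icc a b, ∫ t in I, h v t = 1)
    (hderiv : ∀ x ∈ I, ∀ v ∈ Icc a b, HasDerivWithinAt (fun v => H v x) (Hv v x) (Icc a b) v)
    {v : ℝ} (hv : v ∈ Ioo a b) (x : ℝ) :
    HasDerivAt (fun w => ∫ t in Iic x, I.indicator (h w) t) (I.indicator (Hv v) x) v := by
  simp_rw [setIntegral_Iic_indicator hI.measurableSet]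
  have hn : Icc a b ∈ 𝓝 v := Icc_mem_nhds hv.1 hv.2
  by_cases hx : x ∈ I
  · rw [indicator_of_mem hx]
    refine ((hderiv x hx v (Ioo_subset_Icc_self hv)).hasDerivAt hn).congr_of_eventuallyEq ?_
    filter_upwards [hn] with w hw using (hcdf w hw x hx).symm
  · rw [indicator_of_notMem hx]
    rcases hI.inter_Iic_eq_empty_or_self hx with h | h
    · simpa [h] using hasDerivAt_const v (0 : ℝ)
    · rw [h]
      refine (hasDerivAt_const v (1 : ℝ)).congr_of_eventuallyEq ?_
      filter_upwards [hn] with w hw using hmass w hw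

theorem strictAntiOn_Ioo_of_hasDerivAt_indicator_neg {I : Set ℝ} {a b : ℝ} {F : ℝ → ℝ → ℝ}
    {Hv : ℝ → ℝ → ℝ} (hderiv : ∀ v ∈ Ioo a b, ∀ x,
      HasDerivAt (fun w => F w x) (I.indicator (Hv v) x) v)
    (hneg : ∀ v ∈ Icc a b, ∀ x ∈ I, Hv v x < 0) {x : ℝ} (hx : x ∈ I) :
    StrictAntiOn (fun w => F w x) (Ioo a b) := by
  refine strictAntiOn_of_deriv_neg (convex_Ioo a b)
    (fun w hw => (hderiv w hw x).continuousAt.continuousWithinAt) fun w hw => ?_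
  rw [interior_Ioo] at hw
  rw [(hderiv w hw x).deriv, indicator_of_mem hx]
  exact hneg w (Ioo_subset_Icc_self hw) x hx

/-- If the mean of a family of densities `h v` on `I` is the parameter `v`, and the ratio of the
parameter derivative of the distribution function to the density is monotone both in the point
and in the parameter, then this ratio is identically `-1`. -/
theorem deriv_cdf_eq_neg_density {I : Set ℝ} (hI : I.OrdConnected) {a b : ℝ}
    {h Hv : ℝ → ℝ → ℝ} {B : ℝ → ℝ}
    (hpos : ∀ v ∈ Icc a b, ∀ x ∈ I, 0 < h v x)
    (hint : ∀ v ∈ Icc a b, IntegrableOn (h v) I)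
    (hmass : ∀ v ∈ Icc a b, ∫ t in I, h v t = 1)
    (hmean_int : ∀ v ∈ Icc a b, IntegrableOn (fun x => x * h v x) I)
    (hmean : ∀ v ∈ Icc a b, ∫ x in I, x * h v x = v)
    (hderiv : ∀ v ∈ Ioo a b, ∀ x,
      HasDerivAt (fun w => ∫ t in Iic x, I.indicator (h w) t) (I.indicator (Hv v) x) v)
    (hneg : ∀ v ∈ Icc a b, ∀ x ∈ I, Hv v x < 0)
    (hB : IntegrableOn B I) (hdom : ∀ v ∈ Icc a b, ∀ x ∈ I, |Hv v x| ≤ B x)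
    (hA1 : ∀ v ∈ Icc a b, MonotoneOn (fun x => Hv v x / h v x) I)
    (hA2 : ∀ x ∈ I, MonotoneOn (fun v => Hv v x / h v x) (Ioo a b))
    {v : ℝ} (hv : v ∈ Ioo a b) {x : ℝ} (hx : x ∈ I) : Hv v x = -h v x := by
  have hIm : MeasurableSet I := hI.measurableSet
  have hf : ∀ v ∈ Ioo a b, Integrable (I.indicator (h v)) := fun v hv =>
    (integrable_indicator_iff hIm).2 (hint v (Ioo_subset_Icc_self hv))
  have hf0 : ∀ v ∈ Ioo a b, ∀ x, 0 ≤ I.indicator (h v) x := fun v hv x =>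
    indicator_nonneg (fun x hx => (hpos v (Ioo_subset_Icc_self hv) x hx).le) x
  have hf1 : ∀ v ∈ Ioo a b, ∫ t, I.indicator (h v) t = 1 := fun v hv => by
    rw [integral_indicator hIm, hmass v (Ioo_subset_Icc_self hv)]
  have hxe : ∀ v, (fun t => t * I.indicator (h v) t) = I.indicator fun t => t * h v t := by
    intro v
    ext t
    by_cases ht : t ∈ I <;> simp [ht]
  have hmeanF := fun v hv => integrable_and_integral_setIntegral_Iic_sub_indicator (hf v hv)
    (hf1 v hv) (by
      rw [hxe, integrable_indicator_iff hIm]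
      exact hmean_int v (Ioo_subset_Icc_self hv))
  have hDI : ∀ v ∈ Ioo a b, Integrable (I.indicator (Hv v)) ∧ ∫ x, I.indicator (Hv v) x = -1 := by
    intro v hv
    have hsm : AEStronglyMeasurable (I.indicator (Hv v)) := by
      have hv' := Ioo_subset_Icc_self hv
      refine AEMeasurable.aestronglyMeasurable ((aemeasurable_indicator_iff hIm).2 ?_)
      refine ((aemeasurable_restrict_of_monotoneOn hIm (hA1 v hv')).mul
        (hint v hv').aemeasurable).congr ?_
      filter_upwards [ae_restrict_mem hIm] with x hx
      exact div_mul_cancel₀ _ (hpos v hv' x hx).ne'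
    have key := hasDerivAt_integral_of_dominated_loc_of_deriv_le (μ := volume)
      (F := fun v x => (∫ t in Iic x, I.indicator (h v) t) - (Ici (0 : ℝ)).indicator 1 x)
      (F' := fun v x => I.indicator (Hv v) x) (bound := I.indicator B) (isOpen_Ioo.mem_nhds hv)
      (by filter_upwards [isOpen_Ioo.mem_nhds hv] with w hw using
            (hmeanF w hw).1.aestronglyMeasurable)
      (hmeanF v hv).1 hsm
      (ae_of_all _ fun x w hw => by
        by_cases hx : x ∈ I
        · simpa [hx] using hdom w (Ioo_subset_Icc_self hw) x hx
        · simp [hx])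
      ((integrable_indicator_iff hIm).2 hB)
      (ae_of_all _ fun x w hw => (hderiv w hw x).sub_const _)
    refine ⟨key.1, key.2.unique ?_⟩
    refine (hasDerivAt_neg v).congr_of_eventuallyEq ?_
    filter_upwards [isOpen_Ioo.mem_nhds hv] with w hw
    rw [(hmeanF w hw).2, hxe, integral_indicator hIm, hmean w (Ioo_subset_Icc_self hw)]
  have hanti : ∀ x ∈ I, StrictAntiOn (fun w => ∫ t in Iic x, I.indicator (h w) t) (Ioo a b) :=
    fun x hx => strictAntiOn_Ioo_of_hasDerivAt_indicator_neg hderiv hneg hx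
  set μ : ℝ → Measure ℝ := fun v =>
    volume.withDensity fun x => ENNReal.ofReal (I.indicator (h v) x) with hμ
  have hfm : ∀ v ∈ Ioo a b, AEMeasurable fun x => ENNReal.ofReal (I.indicator (h v) x) :=
    fun v hv => (hf v hv).aestronglyMeasurable.aemeasurable.ennreal_ofReal
  have hμprob : ∀ v ∈ Ioo a b, IsProbabilityMeasure (μ v) := fun v hv => by
    constructor
    rw [hμ, withDensity_apply _ MeasurableSet.univ, setLIntegral_univ,
      ← ofReal_integral_eq_lintegral_ofReal (hf v hv) (ae_of_all _ (hf0 v hv)), hf1 v hv,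
      ENNReal.ofReal_one]
  have hμns : ∀ v, NullSingletonClass (μ v) := fun v =>
    ⟨fun x => withDensity_absolutelyContinuous _ _ (measure_singleton x)⟩
  have hμI : ∀ v, μ v Iᶜ = 0 := fun v => by
    rw [hμ, withDensity_apply _ hIm.compl]
    refine setLIntegral_eq_zero hIm.compl fun x hx => ?_
    simp [indicator_of_notMem hx]
  have hμIic : ∀ v ∈ Ioo a b, ∀ x,
      μ v (Iic x) = ENNReal.ofReal (∫ t in Iic x, I.indicator (h v) t) := fun v hv x => by
    rw [hμ, withDensity_apply _ measurableSet_Iic,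
      ofReal_integral_eq_lintegral_ofReal (hf v hv).integrableOn (ae_of_all _ (hf0 v hv))]
  have hmeanR : ∀ v ∈ Ioo a b, ∫⁻ x, ENNReal.ofReal (-(Hv v x / h v x)) ∂μ v = 1 := by
    intro v hv
    rw [hμ, lintegral_withDensity_eq_lintegral_mul₀' (hfm v hv) (by
      have hr : (μ v).restrict I = μ v :=
        Measure.restrict_eq_self_of_ae_mem (by rw [ae_iff]; exact hμI v)
      have := aemeasurable_restrict_of_monotoneOn (μ := μ v) hIm (hA1 v (Ioo_subset_Icc_self hv))
      rw [hr] at this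
      exact this.neg.ennreal_ofReal)]
    have e : ∀ x, ((fun x => ENNReal.ofReal (I.indicator (h v) x)) *
        fun x => ENNReal.ofReal (-(Hv v x / h v x))) x =
        ENNReal.ofReal (-I.indicator (Hv v) x) := by
      intro x
      by_cases hx : x ∈ I
      · have h0 := hpos v (Ioo_subset_Icc_self hv) x hx
        rw [Pi.mul_apply, indicator_of_mem hx, indicator_of_mem hx, ← ENNReal.ofReal_mul h0.le]
        congr 1
        field_simp
      · simp [hx]
    rw [lintegral_congr e, ← ofReal_integral_eq_lintegral_ofReal
      (f := fun x => -I.indicator (Hv v) x) (hDI v hv).1.neg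
      (ae_of_all _ fun x => ?_), integral_neg, (hDI v hv).2, neg_neg, ENNReal.ofReal_one]
    by_cases hx : x ∈ I
    · simpa [hx] using (hneg v (Ioo_subset_Icc_self hv) x hx).le
    · simp [hx]
  obtain ⟨w, hvw, hwb⟩ := exists_between hv.2
  have hw : w ∈ Ioo a b := ⟨hv.1.trans hvw, hwb⟩
  have := hμprob v hv
  have := hμprob w hw
  have := hμns v
  have := hμns w
  have hconst := eq_of_lintegral_eq_of_measure_Iic_lt hI (hμI v) (hμI w)
    (fun x hx => by
      rw [hμIic v hv, hμIic w hw]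
      exact (ENNReal.ofReal_lt_ofReal_iff_of_nonneg
        (setIntegral_nonneg measurableSet_Iic fun x _ => hf0 w hw x)).2 (hanti x hx hv hw hvw))
    (hA1 v (Ioo_subset_Icc_self hv)).neg (hA1 w (Ioo_subset_Icc_self hw)).neg
    (fun x hx => neg_nonneg.2 (div_nonpos_of_nonpos_of_nonneg
      (hneg w (Ioo_subset_Icc_self hw) x hx).le (hpos w (Ioo_subset_Icc_self hw) x hx).le))
    (fun x hx => neg_le_neg (hA2 x hx hv hw hvw.le))
    (by rw [hmeanR w hw]; exact ENNReal.one_ne_top) ((hmeanR v hv).trans (hmeanR w hw).symm)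
  have h1 := hmeanR v hv
  have hae : ∀ᵐ y ∂μ v, y ∈ I := by
    rw [ae_iff]; exact hμI v
  rw [lintegral_congr_ae (g := fun _ => ENNReal.ofReal (-(Hv v x / h v x)))
    (by filter_upwards [hae] with y hy using congrArg ENNReal.ofReal (hconst y hy x hx)),
    lintegral_const, measure_univ, mul_one, ENNReal.ofReal_eq_one] at h1
  have h0 := hpos v (Ioo_subset_Icc_self hv) x hx
  field_simp at h1
  linarith

theorem Set.OrdConnected.eq_univ_of_add_mem_iff {I : Set ℝ} (hI : I.OrdConnected)
    (hne : I.Nonempty) {d : ℝ} (hd : 0 < d) (h : ∀ x, x + d ∈ I ↔ x ∈ I) : I = univ := by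
  obtain ⟨p, hp⟩ := hne
  have hadd : ∀ n : ℕ, p + n * d ∈ I ∧ p - n * d ∈ I := by
    intro n
    induction n with
    | zero => simpa using hp
    | succ k ih =>
      push_cast
      refine ⟨?_, ?_⟩
      · rw [show p + (k + 1) * d = p + k * d + d by ring, h]
        exact ih.1
      · rw [← h, show p - (k + 1) * d + d = p - k * d by ring]
        exact ih.2
  refine eq_univ_of_forall fun z => ?_
  obtain ⟨n, hn⟩ := exists_nat_ge (|z - p| / d)
  rw [div_le_iff₀ hd] at hn
  obtain ⟨h1, h2⟩ := abs_le.1 hn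
  exact hI.out (hadd n).2 (hadd n).1 ⟨by linarith, by linarith⟩

theorem setIntegral_Iic_comp_add_left (f : ℝ → ℝ) (a x : ℝ) :
    ∫ t in Iic x, f (a + t) = ∫ t in Iic (a + x), f t := by
  have := (measurePreserving_add_left volume a).setIntegral_preimage_emb
    (measurableEmbedding_addLeft a) f (Iic (a + x))
  rwa [preimage_const_add_Iic, add_sub_cancel_left] at this

/-- The support interval of a decreasing translation family of distributions is the whole line. -/
theorem eq_univ_of_eq_translate {I : Set ℝ} (hI : I.OrdConnected) {a b : ℝ} (hab : a < b)
    {h Hv : ℝ → ℝ → ℝ}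
    (hpos : ∀ v ∈ Icc a b, ∀ x ∈ I, 0 < h v x)
    (hint : ∀ v ∈ Icc a b, IntegrableOn (h v) I)
    (hmass : ∀ v ∈ Icc a b, ∫ t in I, h v t = 1)
    (hderiv : ∀ v ∈ Ioo a b, ∀ x,
      HasDerivAt (fun w => ∫ t in Iic x, I.indicator (h w) t) (I.indicator (Hv v) x) v)
    (hneg : ∀ v ∈ Icc a b, ∀ x ∈ I, Hv v x < 0)
    (htr : ∀ v ∈ Ioo a b, ∀ w ∈ Ioo a b, ∀ y,
      ∫ t in Iic (v + y), I.indicator (h v) t = ∫ t in Iic (w + y), I.indicator (h w) t) :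
    I = univ := by
  have hIm := hI.measurableSet
  have hne : I.Nonempty := by
    rw [nonempty_iff_ne_empty]
    rintro rfl
    simpa using hmass a (left_mem_Icc.2 hab.le)
  set F : ℝ → ℝ → ℝ := fun v x => ∫ t in Iic x, I.indicator (h v) t with hF
  have hbd : ∀ v ∈ Ioo a b, ∀ x, 0 ≤ F v x ∧ F v x ≤ 1 := by
    intro v hv x
    have hv' := Ioo_subset_Icc_self hv
    have h0 : 0 ≤ I.indicator (h v) := indicator_nonneg fun x hx => (hpos v hv' x hx).le
    refine ⟨setIntegral_nonneg measurableSet_Iic fun x _ => h0 x, ?_⟩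
    rw [← hmass v hv', ← integral_indicator hIm]
    exact setIntegral_le_integral ((integrable_indicator_iff hIm).2 (hint v hv'))
      (ae_of_all _ h0)
  have hmem : ∀ v ∈ Ioo a b, ∀ x, x ∈ I ↔ 0 < F v x ∧ F v x < 1 := by
    intro v hv x
    constructor
    · intro hx
      have hanti := strictAntiOn_Ioo_of_hasDerivAt_indicator_neg hderiv hneg hx
      obtain ⟨u, hu⟩ := exists_between hv.1
      obtain ⟨w, hw⟩ := exists_between hv.2
      have hu' : u ∈ Ioo a b := ⟨hu.1, hu.2.trans hv.2⟩
      have hw' : w ∈ Ioo a b := ⟨hv.1.trans hw.1, hw.2⟩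
      exact ⟨(hbd w hw' x).1.trans_lt (hanti hv hw' hw.1),
        (hanti hu' hv hu.2).trans_le (hbd u hu' x).2⟩
    · intro h01
      by_contra hx
      simp only [hF, setIntegral_Iic_indicator hIm] at h01
      rcases hI.inter_Iic_eq_empty_or_self hx with h | h
      · simp [h] at h01
      · rw [h, hmass v (Ioo_subset_Icc_self hv)] at h01
        exact lt_irrefl _ h01.2
  obtain ⟨v, hv⟩ := exists_between hab
  obtain ⟨w, hw⟩ := exists_between hv.2
  have hw' : w ∈ Ioo a b := ⟨hv.1.trans hw.1, hw.2⟩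
  refine hI.eq_univ_of_add_mem_iff hne (sub_pos.2 hw.1) fun x => ?_
  have := htr v hv w hw' (x - v)
  rw [add_sub_cancel, show w + (x - v) = x + (w - v) by ring] at this
  rw [hmem w hw', hmem v hv]
  simp only [hF]
  rw [this]

/-- **Proposition 3 (Normalization implies translation).**
For each `v ∈ [vlo, vhi]`, let `H v` be the CDF of an integrable probability distribution
with continuous strictly positive density `h v` on `(Vlo, Vhi)`; suppose `v ↦ H v V` is
continuously differentiable with derivative `Hv v V < 0`, dominated by an integrable `b`,
and the normalization `E[V | v] = ∫ V · h v V dV = v` holds for every `v`.  Then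
Assumptions A1 and A2 both hold if and only if there is a CDF `G` with continuous,
strictly positive density `g` on all of `ℝ` and mean zero such that `H v x = G (x - v)`
for all `v ∈ [vlo, vhi]` and all real `x`; that is, `V - v` is a full-support, mean-zero
random variable that is independent of `v`. -/
theorem stmt_6
    (vlo vhi : ℝ) (hv : vlo < vhi)
    (Vlo Vhi : EReal) (hV : Vlo < Vhi)
    (H h Hv : ℝ → ℝ → ℝ)
    -- `h v` is a continuous strictly positive density on `(Vlo, Vhi)`
    (hh_cont : ∀ v ∈ Icc vlo vhi, ContinuousOn (h v) (ERIoo Vlo Vhi))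
    (hh_pos : ∀ v ∈ Icc vlo vhi, ∀ V ∈ ERIoo Vlo Vhi, 0 < h v V)
    (hh_int : ∀ v ∈ Icc vlo vhi, IntegrableOn (h v) (ERIoo Vlo Vhi))
    -- `H v` is the corresponding CDF of a probability distribution
    (hmono : ∀ v ∈ Icc vlo vhi, Monotone (H v))
    (hcdf : ∀ v ∈ Icc vlo vhi, ∀ x ∈ ERIoo Vlo Vhi,
      H v x = ∫ t in ERIoo Vlo Vhi ∩ Iic x, h v t)
    (hmass : ∀ v ∈ Icc vlo vhi, ∫ t in ERIoo Vlo Vhi, h v t = 1)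
    -- the distribution is integrable, normalized so that `E[V | v] = v`
    (hmean_int : ∀ v ∈ Icc vlo vhi, IntegrableOn (fun x => x * h v x) (ERIoo Vlo Vhi))
    (hnorm : ∀ v ∈ Icc vlo vhi, ∫ x in ERIoo Vlo Vhi, x * h v x = v)
    -- `v ↦ H v V` is continuously differentiable, strictly decreasing in `v`
    (hH_deriv : ∀ V ∈ ERIoo Vlo Vhi, ∀ v ∈ Icc vlo vhi,
      HasDerivWithinAt (fun v => H v V) (Hv v V) (Icc vlo vhi) v)
    (hHv_cont : ∀ V ∈ ERIoo Vlo Vhi, ContinuousOn (fun v => Hv v V) (Icc vlo vhi))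
    (hHv_neg : ∀ v ∈ Icc vlo vhi, ∀ V ∈ ERIoo Vlo Vhi, Hv v V < 0)
    -- dominating integrable function
    (b : ℝ → ℝ)
    (hb_nonneg : ∀ V ∈ ERIoo Vlo Vhi, 0 ≤ b V)
    (hb_int : IntegrableOn b (ERIoo Vlo Vhi))
    (hb_dom : ∀ v ∈ Icc vlo vhi, ∀ V ∈ ERIoo Vlo Vhi, |Hv v V| ≤ b V) :
    -- A1 and A2 hold ...
    ((∀ v ∈ Icc vlo vhi, MonotoneOn (fun V => Hv v V / h v V) (ERIoo Vlo Vhi)) ∧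
      (∀ V ∈ ERIoo Vlo Vhi, MonotoneOn (fun v => Hv v V / h v V) (Ioo vlo vhi)))
    ↔
    -- ... iff `V - v` is a full-support mean-zero random variable independent of `v`:
    -- `H v x = G (x - v)` for a CDF `G` with full-support density `g` and mean zero.
    (∃ G g : ℝ → ℝ,
      Continuous g ∧ (∀ x : ℝ, 0 < g x) ∧
      Integrable g ∧ (∫ x : ℝ, g x) = 1 ∧
      (∀ x : ℝ, G x = ∫ t in Iic x, g t) ∧
      Integrable (fun x : ℝ => x * g x) ∧ (∫ x : ℝ, x * g x) = 0 ∧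
      (∀ v ∈ Icc vlo vhi, ∀ x : ℝ, H v x = G (x - v))) := by
  have hIo : IsOpen (ERIoo Vlo Vhi) := isOpen_ERIoo Vlo Vhi
  have hI : (ERIoo Vlo Vhi).OrdConnected := ordConnected_ERIoo Vlo Vhi
  generalize ERIoo Vlo Vhi = I at *
  have hIm : MeasurableSet I := hI.measurableSet
  have hf : ∀ v ∈ Icc vlo vhi, Integrable (I.indicator (h v)) := fun v hv =>
    (integrable_indicator_iff hIm).2 (hh_int v hv)
  constructor
  · rintro ⟨hA1, hA2⟩
    have hd := fun v hv x => hasDerivAt_setIntegral_Iic_indicator (v := v) hI hcdf hmass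
      hH_deriv hv x
    have hEq : ∀ v ∈ Ioo vlo vhi, ∀ x ∈ I, Hv v x = -h v x := fun v hv x hx =>
      deriv_cdf_eq_neg_density hI hh_pos hh_int hmass hmean_int hnorm hd hHv_neg hb_int hb_dom
        hA1 hA2 hv hx
    have htr : ∀ v ∈ Ioo vlo vhi, ∀ w ∈ Ioo vlo vhi, ∀ y,
        ∫ t in Iic (v + y), I.indicator (h v) t = ∫ t in Iic (w + y), I.indicator (h w) t := by
      intro v hv w hw y
      refine eq_translate_of_hasDerivAt_neg_density (B := I.indicator b)
        (f := fun v => I.indicator (h v)) (fun v hv => hf v (Ioo_subset_Icc_self hv))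
        (fun v hv => indicator_nonneg fun x hx => (hh_pos v (Ioo_subset_Icc_self hv) x hx).le)
        ((integrable_indicator_iff hIm).2 hb_int) (fun v hv x => ?_) (fun v hv x => ?_) hv hw y
      · by_cases hx : x ∈ I
        · have h1 := hb_dom v (Ioo_subset_Icc_self hv) x hx
          rw [hEq v hv x hx, abs_neg] at h1
          simpa [hx] using (le_abs_self _).trans h1
        · simp [hx]
      · refine (hd v hv x).congr_deriv ?_
        by_cases hx : x ∈ I
        · simp [hx, hEq v hv x hx]
        · simp [hx]
    have hIu : I = univ :=
      eq_univ_of_eq_translate hI hv hh_pos hh_int hmass hd hHv_neg htr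
    subst hIu
    simp only [indicator_univ, univ_inter, mem_univ, forall_const, Measure.restrict_univ,
      integrableOn_univ, continuousOn_univ] at *
    obtain ⟨c, hc⟩ := exists_between hv
    have hc' := Ioo_subset_Icc_self hc
    have hGc : Continuous (H c) := by
      rw [funext (hcdf c hc')]
      exact continuous_setIntegral_Iic (hh_int c hc')
    have hgi : Integrable fun y => h c (c + y) := (hh_int c hc').comp_add_left c
    have hxgi : Integrable fun y => (c + y) * h c (c + y) := (hmean_int c hc').comp_add_left c
    have hxg : ∀ y, y * h c (c + y) = (c + y) * h c (c + y) - c * h c (c + y) := fun y => by ring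
    refine ⟨fun y => H c (c + y), fun y => h c (c + y),
      (hh_cont c hc').comp (continuous_const.add continuous_id), fun y => hh_pos c hc' _, hgi,
      ?_, fun y => ?_, ?_, ?_, ?_⟩
    · rw [integral_add_left_eq_self (h c), hmass c hc']
    · exact (hcdf c hc' _).trans (setIntegral_Iic_comp_add_left _ _ _).symm
    · rw [funext hxg]
      exact hxgi.sub (hgi.const_mul c)
    · rw [funext hxg, integral_sub hxgi (hgi.const_mul c), integral_const_mul,
        integral_add_left_eq_self (h c), integral_add_left_eq_self (fun y => y * h c y),
        hmass c hc', hnorm c hc']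
      ring
    · intro v hv' x
      have he : EqOn (fun v => H v x) (fun v => H c (c + (x - v))) (Ioo vlo vhi) := by
        intro w hw
        have := htr w hw c hc (x - w)
        rw [add_sub_cancel] at this
        simp only
        rw [hcdf w (Ioo_subset_Icc_self hw), hcdf c hc', this]
      exact he.of_subset_closure (fun w hw => (hH_deriv x w hw).continuousWithinAt)
        (hGc.comp (continuous_const.add (continuous_const.sub continuous_id))).continuousOn
        Ioo_subset_Icc_self (closure_Ioo hv.ne).ge hv'
  · rintro ⟨G, g, hgc, hgpos, hgi, -, hG, -, -, hHG⟩
    have hGd : ∀ y, HasDerivAt G (g y) y := fun y => by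
      rw [funext hG]
      exact hasDerivAt_setIntegral_Iic hgi isOpen_univ (mem_univ y) hgc.continuousOn
    have hratio : ∀ v ∈ Icc vlo vhi, ∀ x ∈ I, Hv v x / h v x = -1 := by
      intro v hv' x hx
      have h1 : h v x = g (x - v) := by
        have hind : ContinuousOn (I.indicator (h v)) I :=
          (hh_cont v hv').congr fun y hy => indicator_of_mem hy _
        have hd1 := hasDerivAt_setIntegral_Iic (hf v hv') hIo hx hind
        rw [indicator_of_mem hx] at hd1
        refine hd1.unique (((hGd (x - v)).comp_sub_const x v).congr_of_eventuallyEq ?_)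
        filter_upwards [hIo.mem_nhds hx] with y hy
        rw [setIntegral_Iic_indicator hIm, ← hcdf v hv' y hy, hHG v hv']
      have h2 : Hv v x = -g (x - v) := by
        refine (uniqueDiffOn_Icc hv v hv').eq_deriv _ (hH_deriv x hx v hv') ?_
        refine HasDerivWithinAt.congr ?_ (fun w hw => hHG w hw x) (hHG v hv' x)
        exact ((hGd (x - v)).comp_const_sub x v).hasDerivWithinAt
      rw [h1, h2, neg_div, div_self (hgpos _).ne']
    refine ⟨fun v hv' x hx y hy _ => ?_, fun x hx v hv' w hw _ => ?_⟩
    · simp only [hratio v hv' x hx, hratio v hv' y hy, le_refl]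
    · simp only [hratio v (Ioo_subset_Icc_self hv') x hx, hratio w (Ioo_subset_Icc_self hw) x hx,
        le_refl]
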